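/- Let n ≥ 3 be an integer and γ ∈ (0, π/2) with tan(nγ) = n·tan(γ). Then there exist infinitely many pairwise non-similar compact strictly convex bodies Ω ⊂ ℝ² with C^∞ arclength boundary parametrizations, none of which is a disc, each satisfying: every directed chord making angle γ with the boundary at one endpoint makes angle γ with the boundary at the other endpoint. -/

import Mathlib

open Real InnerProductGeometry

/-- The plane `ℝ²`. -/
abbrev Plane := EuclideanSpace ℝ (Fin 2)

/-- `c : ℝ → ℝ²` is a `C¹` arclength parametrization, of period `L`, of the
boundary of the plane body `Ω`. -/
structure IsArclengthParam (Ω : Set Plane) (c : ℝ → Plane) (L : ℝ) : Prop where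
  hL : 0 < L
  contDiff : ContDiff ℝ 1 c
  unitSpeed : ∀ s, ‖deriv c s‖ = 1
  periodic : Function.Periodic c L
  injOn : Set.InjOn c (Set.Ico 0 L)
  range_eq : Set.range c = frontier Ω

/-- Two plane bodies are similar if one is the image of the other under the
composition of an isometry of `ℝ²` and a positive scaling. -/
def SimilarBodies (Ω₁ Ω₂ : Set Plane) : Prop :=
  ∃ r : ℝ, 0 < r ∧ ∃ f : Plane ≃ᵢ Plane, (fun x => r • f x) '' Ω₁ = Ω₂

/-- The linear functional dual to the outer unit normal at tangent angle `b`. -/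
noncomputable def normalForm (b : ℝ) (x : Plane) : ℝ := x 0 * sin b - x 1 * cos b

/-- The linear functional dual to the unit tangent vector at tangent angle `b`. -/
noncomputable def tangentForm (b : ℝ) (x : Plane) : ℝ := x 0 * cos b + x 1 * sin b

/-- The unit vector at angle `b`. -/
noncomputable def unitTangent (b : ℝ) : Plane := !₂[cos b, sin b]

/-- The outer unit normal at tangent angle `b`. -/
noncomputable def outerNormal (b : ℝ) : Plane := !₂[sin b, -cos b]

/-- The boundary curve with support function `1 - d * cos (n * a)`, parametrized by its
tangent angle. -/
noncomputable def floatingCurve (n : ℕ) (d a : ℝ) : Plane :=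
  !₂[(1 - d * cos (n * a)) * sin a + n * d * sin (n * a) * cos a,
    -(1 - d * cos (n * a)) * cos a + n * d * sin (n * a) * sin a]

/-- The convex body with support function `1 - d * cos (n * b)`. -/
def floatingBody (n : ℕ) (d : ℝ) : Set Plane :=
  {x | ∀ b, normalForm b x ≤ 1 - d * cos (n * b)}

lemma norm_sq_eq_coords (x : Plane) : ‖x‖ ^ 2 = x 0 ^ 2 + x 1 ^ 2 := by
  simp [EuclideanSpace.real_norm_sq_eq]

lemma norm_sq_eq_forms (b : ℝ) (x : Plane) :
    ‖x‖ ^ 2 = tangentForm b x ^ 2 + normalForm b x ^ 2 := by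
  rw [norm_sq_eq_coords, tangentForm, normalForm]
  linear_combination -(x 0 ^ 2 + x 1 ^ 2) * sin_sq_add_cos_sq b

lemma norm_unitTangent (b : ℝ) : ‖unitTangent b‖ = 1 := by
  rw [← sq_eq_sq₀ (norm_nonneg _) zero_le_one, norm_sq_eq_coords]
  simp [unitTangent]

lemma norm_outerNormal (b : ℝ) : ‖outerNormal b‖ = 1 := by
  rw [← sq_eq_sq₀ (norm_nonneg _) zero_le_one, norm_sq_eq_coords]
  simp [outerNormal]

lemma inner_unitTangent (b : ℝ) (x : Plane) : inner ℝ x (unitTangent b) = tangentForm b x := by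
  simp [unitTangent, tangentForm, PiLp.inner_apply, Fin.sum_univ_two]
  ring

lemma normalForm_add (b : ℝ) (x y : Plane) :
    normalForm b (x + y) = normalForm b x + normalForm b y := by
  simp [normalForm]; ring

lemma normalForm_sub (b : ℝ) (x y : Plane) :
    normalForm b (x - y) = normalForm b x - normalForm b y := by
  simp [normalForm]; ring

lemma normalForm_smul (b r : ℝ) (x : Plane) : normalForm b (r • x) = r * normalForm b x := by
  simp [normalForm]; ring

lemma normalForm_neg (b : ℝ) (x : Plane) : normalForm b (-x) = -normalForm b x := by
  simp [normalForm]; ring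

lemma normalForm_outerNormal (b : ℝ) : normalForm b (outerNormal b) = 1 := by
  simp [normalForm, outerNormal, ← sq]

lemma normalForm_add_angle (a g : ℝ) (x : Plane) :
    normalForm (a + g) x = cos g * normalForm a x + sin g * tangentForm a x := by
  simp only [normalForm, tangentForm, sin_add, cos_add]; ring

lemma tangentForm_add_angle (a g : ℝ) (x : Plane) :
    tangentForm (a + g) x = cos g * tangentForm a x - sin g * normalForm a x := by
  simp only [normalForm, tangentForm, sin_add, cos_add]; ring

lemma abs_normalForm_le (b : ℝ) (x : Plane) : |normalForm b x| ≤ ‖x‖ := by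
  rw [← abs_of_nonneg (norm_nonneg x), ← sq_le_sq, norm_sq_eq_forms b x]
  nlinarith [sq_nonneg (tangentForm b x)]

lemma normalForm_le_norm (b : ℝ) (x : Plane) : normalForm b x ≤ ‖x‖ :=
  (le_abs_self _).trans (abs_normalForm_le b x)

lemma continuous_normalForm (x : Plane) : Continuous fun b => normalForm b x := by
  unfold normalForm; fun_prop

lemma continuous_normalForm_apply (b : ℝ) : Continuous (normalForm b) := by
  unfold normalForm; fun_prop

lemma exists_normalForm_eq_norm (x : Plane) : ∃ b, normalForm b x = ‖x‖ := by
  refine ⟨Complex.arg ⟨-x 1, x 0⟩, ?_⟩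
  set w : ℂ := ⟨-x 1, x 0⟩ with hw
  have h1 : ‖w‖ * cos w.arg = -x 1 := Complex.norm_mul_cos_arg w
  have h2 : ‖w‖ * sin w.arg = x 0 := Complex.norm_mul_sin_arg w
  have h3 : ‖w‖ = ‖x‖ := by
    rw [← sq_eq_sq₀ (norm_nonneg _) (norm_nonneg _), norm_sq_eq_coords, Complex.sq_norm,
      Complex.normSq_apply]
    ring
  rw [← h3, normalForm, ← h2, ← neg_eq_iff_eq_neg.mpr h1]
  linear_combination ‖w‖ * sin_sq_add_cos_sq w.arg

/-- The values of a linear functional on the vertices of a regular polygon centred at the origin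
sum to zero, so one of them is nonpositive. -/
lemma exists_normalForm_nonpos {n : ℕ} (hn : 2 ≤ n) (θ : ℝ) (x : Plane) :
    ∃ j : ℕ, normalForm (θ + 2 * π * j / n) x ≤ 0 := by
  have hn0 : n ≠ 0 := by lia
  have hsum : ∑ j ∈ Finset.range n,
      Complex.exp (((θ + 2 * π * j / n : ℝ) : ℂ) * Complex.I) = 0 := by
    have h := (Complex.isPrimitiveRoot_exp n hn0).geom_sum_eq_zero (by lia)
    rw [← mul_zero (Complex.exp (θ * Complex.I)), ← h, Finset.mul_sum]
    refine Finset.sum_congr rfl fun j _ => ?_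
    rw [← Complex.exp_nat_mul, ← Complex.exp_add]
    congr 1
    push_cast
    ring
  have hcos : ∑ j ∈ Finset.range n, cos (θ + 2 * π * j / n) = 0 := by
    have := congrArg Complex.re hsum
    simpa only [Complex.re_sum, Complex.exp_ofReal_mul_I_re, Complex.zero_re] using this
  have hsin : ∑ j ∈ Finset.range n, sin (θ + 2 * π * j / n) = 0 := by
    have := congrArg Complex.im hsum
    simpa only [Complex.im_sum, Complex.exp_ofReal_mul_I_im, Complex.zero_im] using this
  by_contra! h
  have hpos : 0 < ∑ j ∈ Finset.range n, normalForm (θ + 2 * π * j / n) x :=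
    Finset.sum_pos (fun j _ => h j) ⟨0, by simp; lia⟩
  simp only [normalForm, Finset.sum_sub_distrib, ← Finset.mul_sum, hcos, hsin] at hpos
  simp at hpos

lemma natCast_mul_add_turn {n : ℕ} (hn : n ≠ 0) (θ : ℝ) (j : ℕ) :
    (n : ℝ) * (θ + 2 * π * j / n) = n * θ + j * (2 * π) := by
  field_simp

section Curve

variable {n : ℕ} {d : ℝ}

lemma normalForm_floatingCurve (n : ℕ) (d b a : ℝ) :
    normalForm b (floatingCurve n d a) =
      (1 - d * cos (n * a)) * cos (b - a) + n * d * sin (n * a) * sin (b - a) := by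
  simp [normalForm, floatingCurve, cos_sub, sin_sub]
  ring

lemma normalForm_floatingCurve_self (n : ℕ) (d b : ℝ) :
    normalForm b (floatingCurve n d b) = 1 - d * cos (n * b) := by
  simp [normalForm_floatingCurve]

lemma cos_natCast_mul_add_int (n : ℕ) (a : ℝ) (k : ℤ) :
    cos (n * (a + k * (2 * π))) = cos (n * a) := by
  rw [← cos_add_int_mul_two_pi (n * a) (n * k)]
  push_cast
  ring_nf

lemma sin_natCast_mul_add_int (n : ℕ) (a : ℝ) (k : ℤ) :
    sin (n * (a + k * (2 * π))) = sin (n * a) := by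
  rw [← sin_add_int_mul_two_pi (n * a) (n * k)]
  push_cast
  ring_nf

lemma floatingCurve_add_int (n : ℕ) (d a : ℝ) (k : ℤ) :
    floatingCurve n d (a + k * (2 * π)) = floatingCurve n d a := by
  simp only [floatingCurve, cos_natCast_mul_add_int, sin_natCast_mul_add_int,
    cos_add_int_mul_two_pi, sin_add_int_mul_two_pi]

lemma normalForm_add_int (b : ℝ) (k : ℤ) (x : Plane) :
    normalForm (b + k * (2 * π)) x = normalForm b x := by
  simp only [normalForm, cos_add_int_mul_two_pi, sin_add_int_mul_two_pi]

lemma unitTangent_add_int (a : ℝ) (k : ℤ) : unitTangent (a + k * (2 * π)) = unitTangent a := by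
  simp only [unitTangent, cos_add_int_mul_two_pi, sin_add_int_mul_two_pi]

lemma exists_int_shift_mem_Ico (a b : ℝ) : ∃ k : ℤ, a + k * (2 * π) ∈ Set.Ico b (b + 2 * π) := by
  obtain ⟨k, hk, -⟩ := existsUnique_add_zsmul_mem_Ico two_pi_pos a b
  exact ⟨k, by simpa [zsmul_eq_mul] using hk⟩

lemma curvatureRadius_pos (hd : 0 < d) (hnd : ((n : ℝ) ^ 2 + 1) * d < 1) (a : ℝ) :
    0 < 1 + ((n : ℝ) ^ 2 - 1) * d * cos (n * a) := by
  have h1 : |cos (n * a)| ≤ 1 := abs_cos_le_one _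
  have h2 : |((n : ℝ) ^ 2 - 1) * d| < 1 := by
    rw [abs_lt]
    constructor <;> nlinarith [mul_nonneg (sq_nonneg (n : ℝ)) hd.le]
  have h3 : |((n : ℝ) ^ 2 - 1) * d * cos (n * a)| < 1 := by
    rw [abs_mul]
    exact (mul_le_of_le_one_right (abs_nonneg _) h1).trans_lt h2
  linarith [(abs_lt.1 h3).1]

lemma hasDerivAt_cos_mul (m a : ℝ) : HasDerivAt (fun t => cos (m * t)) (-sin (m * a) * m) a := by
  simpa using ((hasDerivAt_id a).const_mul m).cos

lemma hasDerivAt_sin_mul (m a : ℝ) : HasDerivAt (fun t => sin (m * t)) (cos (m * a) * m) a := by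
  simpa using ((hasDerivAt_id a).const_mul m).sin

lemma hasDerivAt_floatingCurve (n : ℕ) (d a : ℝ) :
    HasDerivAt (floatingCurve n d)
      ((1 + ((n : ℝ) ^ 2 - 1) * d * cos (n * a)) • unitTangent a) a := by
  have hc := hasDerivAt_cos_mul n a
  have hs := hasDerivAt_sin_mul n a
  have h0 := (((hc.const_mul d).const_sub 1).mul (hasDerivAt_sin a)).add
    ((hs.const_mul (n * d)).mul (hasDerivAt_cos a))
  have h1 := (((hc.const_mul d).const_sub 1).neg.mul (hasDerivAt_cos a)).add
    ((hs.const_mul (n * d)).mul (hasDerivAt_sin a))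
  have hpi : HasDerivAt (fun t => (floatingCurve n d t).ofLp)
      ((1 + ((n : ℝ) ^ 2 - 1) * d * cos (n * a)) • unitTangent a).ofLp a := by
    rw [hasDerivAt_pi]
    intro i
    fin_cases i
    · refine (h0.congr_deriv ?_).congr_of_eventuallyEq ?_
      · simp [unitTangent]; ring
      · exact Filter.Eventually.of_forall fun t => by simp [floatingCurve]
    · refine (h1.congr_deriv ?_).congr_of_eventuallyEq ?_
      · simp [unitTangent]; ring
      · exact Filter.Eventually.of_forall fun t => by simp [floatingCurve]; ring
  exact ((PiLp.continuousLinearEquiv 2 ℝ fun _ : Fin 2 => ℝ).symm.hasFDerivAt.comp_hasDerivAt a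
    hpi :)

lemma continuous_floatingCurve (n : ℕ) (d : ℝ) : Continuous (floatingCurve n d) :=
  continuous_iff_continuousAt.2 fun a => (hasDerivAt_floatingCurve n d a).continuousAt

lemma hasDerivAt_normalForm_floatingCurve (n : ℕ) (d b a : ℝ) :
    HasDerivAt (fun t => normalForm b (floatingCurve n d t))
      ((1 + ((n : ℝ) ^ 2 - 1) * d * cos (n * a)) * sin (b - a)) a := by
  have h := hasDerivAt_floatingCurve n d a
  have h' := hasDerivAt_pi.1
    ((PiLp.continuousLinearEquiv 2 ℝ fun _ : Fin 2 => ℝ).hasFDerivAt.comp_hasDerivAt a h)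
  refine (((h' 0).mul_const (sin b)).sub ((h' 1).mul_const (cos b))).congr_deriv ?_
  simp [unitTangent, sin_sub]
  ring

lemma strictMonoOn_normalForm_floatingCurve (hd : 0 < d) (hnd : ((n : ℝ) ^ 2 + 1) * d < 1) (b : ℝ) :
    StrictMonoOn (fun t => normalForm b (floatingCurve n d t)) (Set.Icc (b - π) b) := by
  refine strictMonoOn_of_deriv_pos (convex_Icc _ _)
    ((continuous_normalForm_apply b).comp (continuous_floatingCurve n d)).continuousOn
    fun a ha => ?_
  rw [interior_Icc] at ha
  rw [(hasDerivAt_normalForm_floatingCurve n d b a).deriv]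
  exact mul_pos (curvatureRadius_pos hd hnd a)
    (sin_pos_of_pos_of_lt_pi (by linarith [ha.2]) (by linarith [ha.1]))

lemma strictAntiOn_normalForm_floatingCurve (hd : 0 < d) (hnd : ((n : ℝ) ^ 2 + 1) * d < 1) (b : ℝ) :
    StrictAntiOn (fun t => normalForm b (floatingCurve n d t)) (Set.Icc b (b + π)) := by
  refine strictAntiOn_of_deriv_neg (convex_Icc _ _)
    ((continuous_normalForm_apply b).comp (continuous_floatingCurve n d)).continuousOn
    fun a ha => ?_
  rw [interior_Icc] at ha
  rw [(hasDerivAt_normalForm_floatingCurve n d b a).deriv]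
  exact mul_neg_of_pos_of_neg (curvatureRadius_pos hd hnd a)
    (sin_neg_of_neg_of_neg_pi_lt (by linarith [ha.1]) (by linarith [ha.2]))

lemma normalForm_floatingCurve_lt (hd : 0 < d) (hnd : ((n : ℝ) ^ 2 + 1) * d < 1) {a b : ℝ}
    (h : ∀ k : ℤ, a + k * (2 * π) ≠ b) :
    normalForm b (floatingCurve n d a) < 1 - d * cos (n * b) := by
  obtain ⟨k, hk1, hk2⟩ := exists_int_shift_mem_Ico a (b - π)
  rw [← normalForm_floatingCurve_self, ← floatingCurve_add_int n d a k]
  have hpi := pi_pos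
  rcases (h k).lt_or_gt with hlt | hgt
  · exact strictMonoOn_normalForm_floatingCurve hd hnd b ⟨hk1, hlt.le⟩
      ⟨by linarith, le_rfl⟩ hlt
  · exact strictAntiOn_normalForm_floatingCurve hd hnd b ⟨le_rfl, by linarith⟩
      ⟨hgt.le, by linarith⟩ hgt

lemma floatingCurve_mem_floatingBody (hd : 0 < d) (hnd : ((n : ℝ) ^ 2 + 1) * d < 1) (a : ℝ) :
    floatingCurve n d a ∈ floatingBody n d := by
  intro b
  by_cases h : ∃ k : ℤ, a + k * (2 * π) = b
  · obtain ⟨k, rfl⟩ := h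
    rw [← floatingCurve_add_int n d a k, normalForm_floatingCurve_self]
  · exact (normalForm_floatingCurve_lt hd hnd (not_exists.1 h)).le

lemma eq_of_floatingCurve_eq (hd : 0 < d) (hnd : ((n : ℝ) ^ 2 + 1) * d < 1) {a b : ℝ}
    (h : floatingCurve n d a = floatingCurve n d b) : ∃ k : ℤ, a + k * (2 * π) = b := by
  by_contra! hne
  have := normalForm_floatingCurve_lt hd hnd hne
  rw [h, normalForm_floatingCurve_self] at this
  exact this.false

lemma eq_floatingCurve_of_normalForm_eq {x : Plane} (hx : x ∈ floatingBody n d) {b : ℝ}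
    (hb : normalForm b x = 1 - d * cos (n * b)) : x = floatingCurve n d b := by
  have hmin : IsLocalMin (fun t => 1 - d * cos (n * t) - (x 0 * sin t - x 1 * cos t)) b :=
    Filter.Eventually.of_forall fun t => by
      have := hx t
      simp only [normalForm] at hb this
      linarith
  have hder := (((hasDerivAt_cos_mul n b).const_mul d).const_sub 1).sub
    (((hasDerivAt_sin b).const_mul (x 0)).sub ((hasDerivAt_cos b).const_mul (x 1)))
  have h0 := hmin.hasDerivAt_eq_zero hder
  rw [normalForm] at hb
  have hsc := sin_sq_add_cos_sq b
  ext i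
  fin_cases i
  · simp [floatingCurve]
    linear_combination sin b * hb - cos b * h0 - x 0 * hsc
  · simp [floatingCurve]
    linear_combination -cos b * hb - sin b * h0 - x 1 * hsc

lemma isClosed_floatingBody (n : ℕ) (d : ℝ) : IsClosed (floatingBody n d) := by
  simp only [floatingBody, Set.ofPred_forall]
  exact isClosed_iInter fun b => isClosed_le (continuous_normalForm_apply b) continuous_const

lemma floatingBody_subset_closedBall (hd : 0 < d) :
    floatingBody n d ⊆ Metric.closedBall 0 (1 + d) := by
  intro x hx
  obtain ⟨b, hb⟩ := exists_normalForm_eq_norm x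
  rw [mem_closedBall_zero_iff, ← hb]
  nlinarith [hx b, neg_one_le_cos (n * b)]

lemma closedBall_subset_floatingBody (hd : 0 < d) :
    Metric.closedBall 0 (1 - d) ⊆ floatingBody n d := by
  intro x hx b
  rw [mem_closedBall_zero_iff] at hx
  nlinarith [normalForm_le_norm b x, cos_le_one (n * b)]

lemma isCompact_floatingBody (hd : 0 < d) : IsCompact (floatingBody n d) :=
  (isCompact_closedBall 0 (1 + d)).of_isClosed_subset (isClosed_floatingBody n d)
    (floatingBody_subset_closedBall hd)

lemma mem_interior_floatingBody {x : Plane} (hx : ∀ b, normalForm b x < 1 - d * cos (n * b)) :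
    x ∈ interior (floatingBody n d) := by
  have hcont : Continuous fun b => 1 - d * cos (n * b) - normalForm b x := by
    have := continuous_normalForm x
    fun_prop
  obtain ⟨b₀, -, hb₀⟩ := isCompact_Icc.exists_isMinOn
    (Set.nonempty_Icc.2 (by linarith [two_pi_pos] : (0 : ℝ) ≤ 0 + 2 * π)) hcont.continuousOn
  rw [mem_interior_iff_mem_nhds]
  refine Filter.mem_of_superset (Metric.closedBall_mem_nhds x (sub_pos.2 (hx b₀))) fun y hy b => ?_
  obtain ⟨k, hk⟩ := exists_int_shift_mem_Ico b 0
  have hmin := isMinOn_iff.1 hb₀ _ (Set.Ico_subset_Icc_self hk)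
  rw [cos_natCast_mul_add_int, normalForm_add_int] at hmin
  rw [Metric.mem_closedBall, dist_eq_norm] at hy
  have := normalForm_le_norm b (y - x)
  rw [normalForm_sub] at this
  linarith

lemma frontier_floatingBody (hd : 0 < d) (hnd : ((n : ℝ) ^ 2 + 1) * d < 1) :
    frontier (floatingBody n d) = Set.range (floatingCurve n d) := by
  rw [(isClosed_floatingBody n d).frontier_eq]
  ext x
  constructor
  · rintro ⟨hx, hxi⟩
    have : ∃ b, ¬ normalForm b x < 1 - d * cos (n * b) := by
      by_contra! h
      exact hxi (mem_interior_floatingBody h)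
    obtain ⟨b, hb⟩ := this
    exact ⟨b, (eq_floatingCurve_of_normalForm_eq hx ((hx b).antisymm (not_lt.1 hb))).symm⟩
  · rintro ⟨b, rfl⟩
    refine ⟨floatingCurve_mem_floatingBody hd hnd b, fun hi => ?_⟩
    obtain ⟨r, hr, hball⟩ := Metric.nhds_basis_closedBall.mem_iff.1
      (mem_interior_iff_mem_nhds.1 hi)
    have hmem : floatingCurve n d b + r • outerNormal b ∈ floatingBody n d :=
      hball (by simp [norm_smul, norm_outerNormal, abs_of_pos hr])
    have := hmem b
    rw [normalForm_add, normalForm_smul, normalForm_outerNormal,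
      normalForm_floatingCurve_self] at this
    linarith

lemma strictConvex_floatingBody (n : ℕ) (d : ℝ) : StrictConvex ℝ (floatingBody n d) := by
  intro x hx y hy hxy a b ha hb hab
  refine mem_interior_floatingBody fun t => ?_
  rw [normalForm_add, normalForm_smul, normalForm_smul]
  have h1 := mul_le_mul_of_nonneg_left (hx t) ha.le
  have h2 := mul_le_mul_of_nonneg_left (hy t) hb.le
  by_contra! h
  have hsum : a * (1 - d * cos (n * t)) + b * (1 - d * cos (n * t)) = 1 - d * cos (n * t) := by
    rw [← add_mul, hab, one_mul]
  have hx' : normalForm t x = 1 - d * cos (n * t) :=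
    mul_left_cancel₀ ha.ne' (by linarith)
  have hy' : normalForm t y = 1 - d * cos (n * t) :=
    mul_left_cancel₀ hb.ne' (by linarith)
  exact hxy ((eq_floatingCurve_of_normalForm_eq hx hx').trans
    (eq_floatingCurve_of_normalForm_eq hy hy').symm)

lemma radius_le_of_closedBall_subset (hn : 2 ≤ n) {p : Plane} {r : ℝ} (hr : 0 ≤ r)
    (h : Metric.closedBall p r ⊆ floatingBody n d) : r ≤ 1 - d := by
  obtain ⟨j, hj⟩ := exists_normalForm_nonpos hn 0 (-p)
  have hmem : p + r • outerNormal (0 + 2 * π * j / n) ∈ floatingBody n d :=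
    h (by simp [norm_smul, norm_outerNormal, abs_of_nonneg hr])
  have := hmem (0 + 2 * π * j / n)
  rw [normalForm_add, normalForm_smul, normalForm_outerNormal,
    natCast_mul_add_turn (by lia), cos_add_nat_mul_two_pi, mul_zero, cos_zero] at this
  rw [normalForm_neg] at hj
  linarith

lemma le_radius_of_floatingCurve_mem (hn : 2 ≤ n) {p : Plane} {r : ℝ}
    (h : ∀ a, floatingCurve n d a ∈ Metric.closedBall p r) : 1 + d ≤ r := by
  have hn0 : (n : ℝ) ≠ 0 := by positivity
  obtain ⟨j, hj⟩ := exists_normalForm_nonpos hn (π / n) p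
  have hb := h (π / n + 2 * π * j / n)
  rw [Metric.mem_closedBall, dist_eq_norm] at hb
  have := (normalForm_le_norm (π / n + 2 * π * j / n) _).trans hb
  rw [normalForm_sub, normalForm_floatingCurve_self, natCast_mul_add_turn (by lia),
    cos_add_nat_mul_two_pi, mul_div_cancel₀ _ hn0, cos_pi] at this
  linarith

lemma le_of_image_floatingBody (hn : 2 ≤ n) {d₁ d₂ r : ℝ} (hd₁ : 0 < d₁) (hd₁' : d₁ < 1)
    (hd₂ : 0 < d₂) (hnd₂ : ((n : ℝ) ^ 2 + 1) * d₂ < 1) (hr : 0 < r) (g : Plane ≃ Plane)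
    (hg : ∀ x y, dist (g x) (g y) = r * dist x y)
    (h : g '' floatingBody n d₁ = floatingBody n d₂) : d₂ ≤ d₁ := by
  have hin : r * (1 - d₁) ≤ 1 - d₂ := by
    refine radius_le_of_closedBall_subset hn (p := g 0) (mul_nonneg hr.le (by linarith))
      fun y hy => ?_
    obtain ⟨x, rfl⟩ := g.surjective y
    rw [Metric.mem_closedBall, hg, mul_le_mul_iff_right₀ hr] at hy
    rw [← h]
    exact Set.mem_image_of_mem _ (closedBall_subset_floatingBody hd₁ hy)
  have hout : 1 + d₂ ≤ r * (1 + d₁) := by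
    refine le_radius_of_floatingCurve_mem (n := n) hn (p := g 0) fun a => ?_
    have ha := floatingCurve_mem_floatingBody hd₂ hnd₂ a
    rw [← h] at ha
    obtain ⟨x, hx, hxa⟩ := ha
    rw [← hxa, Metric.mem_closedBall, hg, mul_le_mul_iff_right₀ hr]
    exact floatingBody_subset_closedBall hd₁ hx
  nlinarith [mul_le_mul_of_nonneg_right hout (by linarith : 0 ≤ 1 - d₁),
    mul_le_mul_of_nonneg_right hin (by linarith : 0 ≤ 1 + d₁)]

lemma eq_of_similarBodies (hn : 2 ≤ n) {d₁ d₂ : ℝ} (hd₁ : 0 < d₁) (hnd₁ : ((n : ℝ) ^ 2 + 1) * d₁ < 1)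
    (hd₂ : 0 < d₂) (hnd₂ : ((n : ℝ) ^ 2 + 1) * d₂ < 1)
    (h : SimilarBodies (floatingBody n d₁) (floatingBody n d₂)) : d₁ = d₂ := by
  obtain ⟨r, hr, f, hf⟩ := h
  let g : Plane ≃ Plane := f.toEquiv.trans (Homeomorph.smulOfNeZero r hr.ne').toEquiv
  have hg : ∀ x y, dist (g x) (g y) = r * dist x y := fun x y => by
    change dist (r • f x) (r • f y) = _
    rw [dist_smul₀, f.dist_eq, Real.norm_of_nonneg hr.le]
  have hgs : ∀ x y, dist (g.symm x) (g.symm y) = r⁻¹ * dist x y := fun x y => by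
    rw [← g.apply_symm_apply x, ← g.apply_symm_apply y, hg]
    simp [hr.ne']
  have hfg : g '' floatingBody n d₁ = floatingBody n d₂ := hf
  refine le_antisymm
    (le_of_image_floatingBody hn hd₂ (by nlinarith) hd₁ hnd₁ (inv_pos.2 hr) g.symm hgs ?_)
    (le_of_image_floatingBody hn hd₁ (by nlinarith) hd₂ hnd₂ hr g hg hfg)
  rw [← hfg, Equiv.symm_image_image]

lemma not_forall_norm_floatingCurve_sub_eq (hn : 2 ≤ n) (hd : 0 < d)
    (hnd : ((n : ℝ) ^ 2 + 1) * d < 1) (p : Plane) (r : ℝ) :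
    ¬ ∀ a, ‖floatingCurve n d a - p‖ = r := by
  intro h
  have hn0 : (n : ℝ) ≠ 0 := by positivity
  have htan : ∀ a, n * d * sin (n * a) = normalForm (a + π / 2) p := fun a => by
    have hder := ((hasDerivAt_floatingCurve n d a).sub_const p).norm_sq
    have hconst : (fun t => ‖floatingCurve n d t - p‖ ^ 2) = fun _ => r ^ 2 :=
      funext fun t => by rw [h t]
    rw [hconst] at hder
    have h0 := hder.unique (hasDerivAt_const a (r ^ 2))
    rw [inner_smul_right, inner_unitTangent] at h0
    have h1 := (mul_eq_zero.1 ((mul_eq_zero.1 h0).resolve_left two_ne_zero)).resolve_left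
      (curvatureRadius_pos hd hnd a).ne'
    simp only [tangentForm, floatingCurve, normalForm, sin_add_pi_div_two, cos_add_pi_div_two,
      PiLp.sub_apply] at h1 ⊢
    simp at h1
    linear_combination h1 - n * d * sin (n * a) * sin_sq_add_cos_sq a
  obtain ⟨j, hj⟩ := exists_normalForm_nonpos hn (π / 2 / n + π / 2) p
  have := htan (π / 2 / n + 2 * π * j / n)
  rw [natCast_mul_add_turn (by lia), sin_add_nat_mul_two_pi, mul_div_cancel₀ _ hn0,
    sin_pi_div_two, add_right_comm] at this
  have : 0 < n * d * 1 := by positivity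
  linarith

end Curve

section Chord

variable {n : ℕ} {d γ : ℝ}

lemma angle_eq_of_tangentForm {a : ℝ} {v : Plane} (hv : v ≠ 0) (hγ0 : 0 ≤ γ) (hγ1 : γ ≤ π)
    (h : tangentForm a v = cos γ * ‖v‖) : angle v (unitTangent a) = γ := by
  rw [angle, inner_unitTangent, norm_unitTangent, mul_one, h,
    mul_div_cancel_right₀ _ (norm_ne_zero_iff.2 hv), arccos_cos hγ0 hγ1]

lemma normalForm_floatingCurve_add_sub (htan : sin (n * γ) * cos γ = n * sin γ * cos (n * γ))
    (d b : ℝ) :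
    normalForm b (floatingCurve n d (b + γ)) = normalForm b (floatingCurve n d (b - γ)) := by
  simp only [normalForm_floatingCurve, sub_add_cancel_left, sub_sub_cancel, cos_neg, sin_neg,
    mul_add, mul_sub, cos_add, cos_sub, sin_add, sin_sub]
  linear_combination 2 * d * sin (n * b) * htan

lemma angle_floatingCurve (hd : 0 < d) (hnd : ((n : ℝ) ^ 2 + 1) * d < 1) (hγ0 : 0 < γ)
    (hγ1 : γ < π / 2) (htan : sin (n * γ) * cos γ = n * sin γ * cos (n * γ)) {a b : ℝ}
    (hne : floatingCurve n d a ≠ floatingCurve n d b)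
    (hangle : angle (floatingCurve n d b - floatingCurve n d a) (unitTangent a) = γ) :
    angle (floatingCurve n d b - floatingCurve n d a) (unitTangent b) = γ := by
  obtain ⟨k, hk1, hk2⟩ := exists_int_shift_mem_Ico b (a + γ - π)
  rw [← floatingCurve_add_int n d b k] at hne hangle ⊢
  rw [← unitTangent_add_int b k]
  generalize b + k * (2 * π) = b at *
  set v := floatingCurve n d b - floatingCurve n d a with hv
  have hv0 : v ≠ 0 := sub_ne_zero.2 hne.symm
  have hsinγ : 0 < sin γ := sin_pos_of_pos_of_lt_pi hγ0 (by linarith)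
  have htv : tangentForm a v = cos γ * ‖v‖ := by
    rw [← inner_unitTangent, ← cos_angle_mul_norm_mul_norm, norm_unitTangent, mul_one, hangle]
  have hnv : normalForm a v = -(sin γ * ‖v‖) := by
    have hle : normalForm a v ≤ 0 := by
      rw [hv, normalForm_sub, normalForm_floatingCurve_self]
      exact sub_nonpos.2 (floatingCurve_mem_floatingBody hd hnd b a)
    have hsq : (-normalForm a v) ^ 2 = (sin γ * ‖v‖) ^ 2 := by
      have := norm_sq_eq_forms a v
      rw [htv] at this
      linear_combination -this - ‖v‖ ^ 2 * sin_sq_add_cos_sq γ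
    have := (sq_eq_sq₀ (by linarith) (by positivity)).1 hsq
    linarith
  have hmid : normalForm (a + γ) (floatingCurve n d b) =
      normalForm (a + γ) (floatingCurve n d a) := by
    rw [← sub_eq_zero, ← normalForm_sub, ← hv, normalForm_add_angle, hnv, htv]
    ring
  have hb : b = a + γ + γ := by
    rcases le_total b (a + γ) with hle | hge
    · have := (strictMonoOn_normalForm_floatingCurve hd hnd (a + γ)).injOn ⟨hk1, hle⟩
        ⟨by linarith, by linarith⟩ hmid
      exact absurd (congrArg (floatingCurve n d) this.symm) hne
    · refine (strictAntiOn_normalForm_floatingCurve hd hnd (a + γ)).injOn ⟨hge, by linarith⟩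
        ⟨by linarith, by linarith⟩ ?_
      rw [normalForm_floatingCurve_add_sub htan, add_sub_cancel_right, hmid]
  refine angle_eq_of_tangentForm hv0 hγ0.le (by linarith) ?_
  rw [hb, tangentForm_add_angle, tangentForm_add_angle, normalForm_add_angle, hnv, htv]
  linear_combination cos γ * ‖v‖ * sin_sq_add_cos_sq γ

lemma sin_mul_cos_eq_of_tan_eq (hn : n ≠ 0) (hγ0 : 0 < γ) (hγ1 : γ < π / 2)
    (h : tan (n * γ) = n * tan γ) : sin (n * γ) * cos γ = n * sin γ * cos (n * γ) := by
  have hcos : cos γ ≠ 0 := (cos_pos_of_mem_Ioo ⟨by linarith, hγ1⟩).ne'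
  have hcosn : cos (n * γ) ≠ 0 := fun h0 => by
    have htan : 0 < n * tan γ := mul_pos (by positivity) (tan_pos_of_pos_of_lt_pi_div_two hγ0 hγ1)
    rw [← h, tan_eq_sin_div_cos, h0, div_zero] at htan
    exact htan.false
  rw [tan_eq_sin_div_cos, tan_eq_sin_div_cos] at h
  field_simp at h
  linear_combination h

end Chord

section Arclength

variable {n : ℕ} {d : ℝ}

/-- The arclength of `floatingCurve n d` as a function of the tangent angle. -/
noncomputable def arclength (n : ℕ) (d a : ℝ) : ℝ := a + (n - (n : ℝ)⁻¹) * d * sin (n * a)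

lemma hasDerivAt_arclength (hn : n ≠ 0) (d a : ℝ) :
    HasDerivAt (arclength n d) (1 + ((n : ℝ) ^ 2 - 1) * d * cos (n * a)) a := by
  have hn0 : (n : ℝ) ≠ 0 := by exact_mod_cast hn
  refine ((hasDerivAt_id a).add
    ((hasDerivAt_sin_mul n a).const_mul ((n - (n : ℝ)⁻¹) * d))).congr_deriv ?_
  field_simp

lemma continuous_arclength (n : ℕ) (d : ℝ) : Continuous (arclength n d) := by
  unfold arclength; fun_prop

lemma strictMono_arclength (hn : n ≠ 0) (hd : 0 < d) (hnd : ((n : ℝ) ^ 2 + 1) * d < 1) :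
    StrictMono (arclength n d) :=
  strictMono_of_deriv_pos fun a => by
    rw [(hasDerivAt_arclength hn d a).deriv]
    exact curvatureRadius_pos hd hnd a

lemma surjective_arclength (n : ℕ) (d : ℝ) : Function.Surjective (arclength n d) := by
  intro y
  set C := |(n - (n : ℝ)⁻¹) * d| with hC
  have hbound : ∀ a, |(n - (n : ℝ)⁻¹) * d * sin (n * a)| ≤ C := fun a => by
    rw [abs_mul]
    exact mul_le_of_le_one_right (abs_nonneg _) (abs_sin_le_one _)
  refine mem_range_of_exists_le_of_exists_ge (continuous_arclength n d) ⟨y - C, ?_⟩ ⟨y + C, ?_⟩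
  · have := (abs_le.1 (hbound (y - C))).2
    rw [arclength]; linarith
  · have := (abs_le.1 (hbound (y + C))).1
    rw [arclength]; linarith

lemma arclength_add_int (n : ℕ) (d a : ℝ) (k : ℤ) :
    arclength n d (a + k * (2 * π)) = arclength n d a + k * (2 * π) := by
  rw [arclength, sin_natCast_mul_add_int, arclength]; ring

/-- The tangent angle of `floatingCurve n d` is a smooth function of the arclength. -/
lemma exists_tangentAngle (hn : n ≠ 0) (hd : 0 < d) (hnd : ((n : ℝ) ^ 2 + 1) * d < 1) :
    ∃ A : ℝ → ℝ, ContDiff ℝ (⊤ : ℕ∞) A ∧ (∀ s, arclength n d (A s) = s) ∧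
      (∀ a, A (arclength n d a) = a) ∧
      ∀ s, HasDerivAt A (1 + ((n : ℝ) ^ 2 - 1) * d * cos (n * A s))⁻¹ s := by
  let e : ℝ ≃ₜ ℝ := ((strictMono_arclength hn hd hnd).orderIsoOfSurjective _
    (surjective_arclength n d)).toHomeomorph
  have he : ∀ a, e a = arclength n d a := fun _ => rfl
  refine ⟨e.symm, ?_, fun s => e.apply_symm_apply s, fun a => e.symm_apply_apply a, fun s => ?_⟩
  · refine e.contDiff_symm_deriv (fun a => (curvatureRadius_pos hd hnd a).ne')
      (hasDerivAt_arclength hn d) ?_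
    change ContDiff ℝ _ (arclength n d)
    unfold arclength
    fun_prop
  · exact HasDerivAt.of_local_left_inverse e.symm.continuous.continuousAt
      (hasDerivAt_arclength hn d _) (curvatureRadius_pos hd hnd _).ne'
      (Filter.Eventually.of_forall fun t => e.apply_symm_apply t)

lemma contDiff_floatingCurve (n : ℕ) (d : ℝ) : ContDiff ℝ (⊤ : ℕ∞) (floatingCurve n d) := by
  rw [contDiff_euclidean]
  intro i
  fin_cases i
  · simp only [floatingCurve, Fin.zero_eta, Fin.isValue, PiLp.toLp_apply, Matrix.cons_val_zero]
    fun_prop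
  · simp only [floatingCurve, Fin.mk_one, Fin.isValue, PiLp.toLp_apply, Matrix.cons_val_one,
      Matrix.cons_val_zero]
    fun_prop

lemma exists_isArclengthParam_floatingBody (hn : n ≠ 0) (hd : 0 < d)
    (hnd : ((n : ℝ) ^ 2 + 1) * d < 1) :
    ∃ A : ℝ → ℝ, Function.Surjective A ∧
      ContDiff ℝ (⊤ : ℕ∞) (fun s => floatingCurve n d (A s)) ∧
      (∀ s, deriv (fun s => floatingCurve n d (A s)) s = unitTangent (A s)) ∧
      IsArclengthParam (floatingBody n d) (fun s => floatingCurve n d (A s)) (2 * π) := by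
  obtain ⟨A, hA, hSA, hAS, hA'⟩ := exists_tangentAngle hn hd hnd
  have hsurj : Function.Surjective A := fun a => ⟨_, hAS a⟩
  have hsmooth : ContDiff ℝ (⊤ : ℕ∞) (fun s => floatingCurve n d (A s)) :=
    (contDiff_floatingCurve n d).comp hA
  have hderiv : ∀ s, deriv (fun s => floatingCurve n d (A s)) s = unitTangent (A s) := fun s => by
    have := ((hasDerivAt_floatingCurve n d (A s)).scomp s (hA' s)).deriv
    rwa [smul_smul, inv_mul_cancel₀ (curvatureRadius_pos hd hnd _).ne', one_smul] at this
  have hshift : ∀ s (k : ℤ), A (s + k * (2 * π)) = A s + k * (2 * π) := fun s k => by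
    rw [← hAS (A s + k * (2 * π)), arclength_add_int, hSA]
  refine ⟨A, hsurj, hsmooth, hderiv, two_pi_pos, hsmooth.of_le (by simp), fun s => ?_, fun s => ?_,
    fun s hs t ht hst => ?_, ?_⟩
  · rw [hderiv, norm_unitTangent]
  · have := hshift s 1
    simp only [Int.cast_one, one_mul] at this
    have h2 := floatingCurve_add_int n d (A s) 1
    simp only [Int.cast_one, one_mul] at h2
    simp only [this, h2]
  · obtain ⟨k, hk⟩ := eq_of_floatingCurve_eq hd hnd hst
    have hk' : s + k * (2 * π) = t := by rw [← hSA t, ← hk, arclength_add_int, hSA]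
    have hpi := two_pi_pos
    have h1 : (k : ℝ) < 1 := by by_contra! h; nlinarith [hs.1, ht.2]
    have h2 : (-1 : ℝ) < k := by by_contra! h; nlinarith [hs.2, ht.1]
    have hk0 : k = 0 := by
      have : k < 1 := by exact_mod_cast h1
      have : -1 < k := by exact_mod_cast h2
      lia
    rw [← hk', hk0]
    simp
  · rw [frontier_floatingBody hd hnd]
    exact hsurj.range_comp (floatingCurve n d)

end Arclength

/-- for every `n ≥ 3` and `γ ∈ (0, π/2)` with `tan (n γ) = n tan γ`
there are infinitely many pairwise non-similar, non-circular, compact strictly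
convex plane bodies with `C^∞` boundary, each floating in neutral equilibrium in
every orientation at the contact angle `π − γ`. -/
theorem infinitely_many_floating_bodies (n : ℕ) (hn : 3 ≤ n) (γ : ℝ)
    (hγ0 : 0 < γ) (hγ1 : γ < π / 2) (hγ : Real.tan (n * γ) = n * Real.tan γ) :
    ∃ F : ℕ → Set Plane,
      (∀ k, IsCompact (F k) ∧ StrictConvex ℝ (F k) ∧ (interior (F k)).Nonempty ∧
        ∃ (c : ℝ → Plane) (L : ℝ),
          IsArclengthParam (F k) c L ∧ ContDiff ℝ (⊤ : ℕ∞) c ∧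
          (¬ ∃ (x₀ : Plane) (r : ℝ), 0 < r ∧ ∀ s : ℝ, ‖c s - x₀‖ = r) ∧
          ∀ s t : ℝ, c s ≠ c t →
            angle (c t - c s) (deriv c s) = γ →
            angle (c t - c s) (deriv c t) = γ) ∧
      Pairwise fun j k => ¬ SimilarBodies (F j) (F k) := by
  have hn0 : n ≠ 0 := by lia
  have htan := sin_mul_cos_eq_of_tan_eq hn0 hγ0 hγ1 hγ
  let δ : ℕ → ℝ := fun k => (((n : ℝ) ^ 2 + 1) * (k + 2))⁻¹
  have hδ : ∀ k, 0 < δ k := fun k => by positivity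
  have hnδ : ∀ k, ((n : ℝ) ^ 2 + 1) * δ k < 1 := fun k => by
    have : ((n : ℝ) ^ 2 + 1) * δ k = ((k : ℝ) + 2)⁻¹ := by
      simp only [δ]
      field_simp
    rw [this]
    exact inv_lt_one_of_one_lt₀ (by linarith [k.cast_nonneg (α := ℝ)])
  refine ⟨fun k => floatingBody n (δ k), fun k => ⟨isCompact_floatingBody (hδ k),
    strictConvex_floatingBody n _, ⟨0, mem_interior_floatingBody fun b => ?_⟩, ?_⟩,
    fun j k hjk hsim => hjk ?_⟩
  · have h0 : normalForm b 0 = 0 := by simp [normalForm]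
    nlinarith [hδ k, hnδ k, cos_le_one (n * b)]
  · obtain ⟨A, hsurj, hsmooth, hderiv, hparam⟩ :=
      exists_isArclengthParam_floatingBody hn0 (hδ k) (hnδ k)
    refine ⟨_, _, hparam, hsmooth, ?_, fun s t hst hangle => ?_⟩
    · rintro ⟨p, r, -, h⟩
      refine not_forall_norm_floatingCurve_sub_eq (by lia) (hδ k) (hnδ k) p r fun a => ?_
      obtain ⟨s, rfl⟩ := hsurj a
      exact h s
    · rw [hderiv] at hangle ⊢
      exact angle_floatingCurve (hδ k) (hnδ k) hγ0 hγ1 htan hst hangle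
  · have h := eq_of_similarBodies (by lia) (hδ j) (hnδ j) (hδ k) (hnδ k) hsim
    have h2 : ((n : ℝ) ^ 2 + 1) * (j + 2) = ((n : ℝ) ^ 2 + 1) * (k + 2) := inv_injective h
    have h3 := mul_left_cancel₀ (by positivity) h2
    exact_mod_cast add_right_cancel h3
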